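/- Let (u_z)_{z∈ℂ} be an analytic unitary representation on A. Then the group law extends to the whole complex plane: for all y, z ∈ ℂ one has u_{y+z} = u_y · u_z. -/

import Mathlib

open scoped ComplexOrder

/-- An analytic unitary representation on a unital complex `*`-algebra `A` : a family
`(u z)_{z ∈ ℂ}` of elements of `A` such that `u t` is unitary for every real `t`, the real
group law holds, and the functions `z ↦ φ (a * u z)` and `z ↦ φ (u z * a)` are entire. -/
structure AnalyticUnitaryRep {A : Type*} [Ring A] [Algebra ℂ A] [StarRing A]
    [StarModule ℂ A] (φ : A →ₗ[ℂ] ℂ) (u : ℂ → A) : Prop where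
  real_unitary : ∀ t : ℝ, star (u (t : ℂ)) * u (t : ℂ) = 1 ∧ u (t : ℂ) * star (u (t : ℂ)) = 1
  real_group : ∀ s t : ℝ, u ((s : ℂ) + (t : ℂ)) = u (s : ℂ) * u (t : ℂ)
  entire_left : ∀ a : A, Differentiable ℂ fun z : ℂ => φ (a * u z)
  entire_right : ∀ a : A, Differentiable ℂ fun z : ℂ => φ (u z * a)

open Filter Topology in
/-- Two entire functions that agree on the real axis are equal. -/
theorem Differentiable.eq_of_eq_ofReal {f g : ℂ → ℂ} (hf : Differentiable ℂ f)
    (hg : Differentiable ℂ g) (h : ∀ t : ℝ, f t = g t) : f = g := by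
  have hlim : Tendsto ((↑) : ℝ → ℂ) (𝓝[≠] 0) (𝓝[≠] ((0 : ℝ) : ℂ)) :=
    Complex.continuous_ofReal.continuousWithinAt.tendsto_nhdsWithin fun t ht => by
      simpa using ht
  exact AnalyticOnNhd.eq_of_frequently_eq (fun z _ => hf.analyticAt z)
    (fun z _ => hg.analyticAt z) (hlim.frequently (Frequently.of_forall h))

/-- The group law of an analytic unitary representation holds when the first parameter is real. -/
theorem AnalyticUnitaryRep.map_ofReal_add {A : Type*} [Ring A] [Algebra ℂ A] [StarRing A]
    [StarModule ℂ A] {φ : A →ₗ[ℂ] ℂ} (hfaith : ∀ a : A, φ (star a * a) = 0 → a = 0)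
    {u : ℂ → A} (hu : AnalyticUnitaryRep φ u) (s : ℝ) (z : ℂ) :
    u (s + z) = u s * u z := by
  have key (a : A) : (fun z : ℂ => φ (a * u (s + z))) = fun z => φ (a * u s * u z) :=
    ((hu.entire_left a).comp (differentiable_id.const_add (s : ℂ))).eq_of_eq_ofReal
      (hu.entire_left (a * u s)) fun t => by
        simp only [Function.comp_apply, id_eq, hu.real_group, mul_assoc]
  refine sub_eq_zero.1 (hfaith _ ?_)
  rw [mul_sub, map_sub, sub_eq_zero, ← mul_assoc]
  exact congrFun (key _) z

/-- The group law of an analytic unitary representation extends to all complex parameters: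
`u (y + z) = u y * u z`. -/
theorem analyticUnitaryRep_group {A : Type*} [Ring A] [Algebra ℂ A] [StarRing A] [StarModule ℂ A]
    (φ : A →ₗ[ℂ] ℂ)
    (hpos : ∀ a : A, 0 ≤ φ (star a * a))
    (hfaith : ∀ a : A, φ (star a * a) = 0 → a = 0)
    (u : ℂ → A) (hu : AnalyticUnitaryRep φ u)
    (y z : ℂ) :
    u (y + z) = u y * u z := by
  have key (a : A) : (fun y : ℂ => φ (u (y + z) * a)) = fun y => φ (u y * (u z * a)) :=
    ((hu.entire_right a).comp (differentiable_id.add_const z)).eq_of_eq_ofReal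
      (hu.entire_right (u z * a)) fun t => by
        simp only [Function.comp_apply, id_eq, hu.map_ofReal_add hfaith, mul_assoc]
  refine sub_eq_zero.1 (star_eq_zero.1 (hfaith _ ?_))
  rw [star_star, sub_mul, map_sub, sub_eq_zero, mul_assoc]
  exact congrFun (key _) y
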